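/- arXiv:1106.4219 — 5 statements merged into one kernel-verified Lean document; each statement's English description precedes it below -/
import Mathlib

section
/- Let E be a principal ideal domain and let f₁, f₂ ∈ E[x] be nonzero and coprime (every common divisor is a unit). Then the ideal (f₁, f₂) of E[x] contains a nonzero constant c ∈ E as well as a monic polynomial. Moreover, for any nonzero c ∈ E lying in (f₁, f₂), if the quotient ring E/(c) is finite then the quotient ring E[x]/(f₁, f₂) is also finite. -/
open Polynomial

lemma aux_const {E : Type*} [CommRing E] [IsDomain E] [IsPrincipalIdealRing E]
    (f₁ f₂ : E[X]) (hf₁ : f₁ ≠ 0) (hcop : IsRelPrime f₁ f₂) :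
    ∃ c : E, c ≠ 0 ∧ (C c : E[X]) ∈ Ideal.span {f₁, f₂} := by
  classical
  let _ := Classical.choice (inferInstance : Nonempty (NormalizedGCDMonoid E))
  let K := FractionRing E
  have hinj : Function.Injective (algebraMap E K) := IsFractionRing.injective E K
  have hco : IsCoprime (f₁.map (algebraMap E K)) (f₂.map (algebraMap E K)) := by
    rw [← isRelPrime_iff_isCoprime]
    intro d h1 h2
    have hd0 : d ≠ 0 := by
      rintro rfl
      rw [zero_dvd_iff, Polynomial.map_eq_zero_iff hinj] at h1
      exact hf₁ h1
    obtain ⟨b, hb, hbm⟩ := IsLocalization.integerNormalization_spec (nonZeroDivisors E) d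
    set q := (IsLocalization.integerNormalization (nonZeroDivisors E) d) with hq
    have hb0 : (algebraMap E K) b ≠ 0 := by
      rw [Ne, map_eq_zero_iff _ hinj]
      exact nonZeroDivisors.ne_zero hb
    have hbm' : q.map (algebraMap E K) = C (algebraMap E K b) * d := by
      rw [hbm, Algebra.smul_def]; rfl
    have hq0 : q ≠ 0 := by
      intro h
      rw [h, Polynomial.map_zero] at hbm'
      exact mul_ne_zero (by simpa using hb0) hd0 hbm'.symm
    have hcont : (algebraMap E K) q.content ≠ 0 := by
      rw [Ne, map_eq_zero_iff _ hinj]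
      simpa [content_eq_zero_iff] using hq0
    have hqd : q.map (algebraMap E K) =
        C (algebraMap E K q.content) * q.primPart.map (algebraMap E K) := by
      conv_lhs => rw [q.eq_C_content_mul_primPart]
      simp
    have hu1 : IsUnit (C (algebraMap E K b)) := isUnit_C.2 (isUnit_iff_ne_zero.2 hb0)
    have hu2 : IsUnit (C (algebraMap E K q.content)) := isUnit_C.2 (isUnit_iff_ne_zero.2 hcont)
    have key : ∀ f : E[X], d ∣ f.map (algebraMap E K) → q.primPart ∣ f := by
      intro f hf
      by_cases hf0 : f = 0
      · simp [hf0]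
      have h3 : q.primPart.map (algebraMap E K) ∣ f.map (algebraMap E K) := by
        rw [← hu2.mul_left_dvd, ← hqd, hbm', hu1.mul_left_dvd]; exact hf
      have hcf : (algebraMap E K) f.content ≠ 0 := by
        rw [Ne, map_eq_zero_iff _ hinj]
        simpa [content_eq_zero_iff] using hf0
      have hu3 : IsUnit (C (algebraMap E K f.content)) := isUnit_C.2 (isUnit_iff_ne_zero.2 hcf)
      have h4 : f.map (algebraMap E K) =
          C (algebraMap E K f.content) * f.primPart.map (algebraMap E K) := by
        conv_lhs => rw [f.eq_C_content_mul_primPart]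
        simp
      rw [h4, hu3.dvd_mul_left] at h3
      exact ((isPrimitive_primPart q).dvd_of_fraction_map_dvd_fraction_map
        h3).trans (primPart_dvd f)
    have hu := hcop (key f₁ h1) (key f₂ h2)
    have := hu.map (mapRingHom (algebraMap E K))
    rw [coe_mapRingHom] at this
    have h5 := hu2.mul this
    rw [← hqd, hbm'] at h5
    exact isUnit_of_mul_isUnit_right h5
  obtain ⟨u, v, huv⟩ := hco
  obtain ⟨b, hb, hbm⟩ := IsLocalization.integerNormalization_spec (nonZeroDivisors E) u
  obtain ⟨b', hb', hbm'⟩ := IsLocalization.integerNormalization_spec (nonZeroDivisors E) v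
  rw [Algebra.smul_def] at hbm hbm'
  refine ⟨b * b', mul_ne_zero (nonZeroDivisors.ne_zero hb) (nonZeroDivisors.ne_zero hb'), ?_⟩
  rw [Ideal.mem_span_pair]
  refine ⟨C b' * IsLocalization.integerNormalization (nonZeroDivisors E) u,
    C b * IsLocalization.integerNormalization (nonZeroDivisors E) v, ?_⟩
  apply Polynomial.map_injective _ hinj
  simp only [Polynomial.map_add, Polynomial.map_mul, map_C, hbm, hbm', map_mul]
  change C (algebraMap E K b') * (C (algebraMap E K b) * u) * _ +
    C (algebraMap E K b) * (C (algebraMap E K b') * v) * _ = _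
  linear_combination (C (algebraMap E K b) * C (algebraMap E K b')) * huv

lemma aux_prime {E : Type*} [CommRing E] [IsDomain E] [IsPrincipalIdealRing E]
    (f : E[X]) (p : E) (hp : Prime p) (h : ¬ C p ∣ f) :
    ∃ g a b : E[X], g.Monic ∧ g = a * f + b * C p := by
  have hmax : (Ideal.span {p}).IsMaximal :=
    PrincipalIdealRing.isMaximal_of_irreducible hp.irreducible
  letI := Ideal.Quotient.field (Ideal.span {p})
  let φ := Ideal.Quotient.mk (Ideal.span {p})
  have hφ : Function.Surjective φ := Ideal.Quotient.mk_surjective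
  have hker : ∀ r : E[X], r.map φ = 0 → C p ∣ r := by
    intro r hr
    rw [C_dvd_iff_dvd_coeff]
    intro i
    have := congrArg (fun s => s.coeff i) hr
    simp only [coeff_map, coeff_zero] at this
    exact Ideal.mem_span_singleton.1 (Ideal.Quotient.eq_zero_iff_mem.1 this)
  have h0 : f.map φ ≠ 0 := fun h' => h (hker f h')
  have hm := monic_mul_leadingCoeff_inv h0
  obtain ⟨a, ha⟩ := hφ (f.map φ).leadingCoeff⁻¹
  rw [← ha] at hm
  have hl : f.map φ * C (φ a) ∈ lifts φ := by
    rw [mem_lifts]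
    exact ⟨f * C a, by simp⟩
  obtain ⟨g, hg, -, hgm⟩ := lifts_and_natDegree_eq_and_monic hl hm
  obtain ⟨b, hb⟩ := hker (g - C a * f) (by simp [hg, mul_comm])
  exact ⟨g, C a, b, hgm, by linear_combination hb⟩

lemma aux_monic {E : Type*} [CommRing E] [IsDomain E] [IsPrincipalIdealRing E]
    (f₁ f₂ : E[X]) (hcop : IsRelPrime f₁ f₂) (c : E) (hc : c ≠ 0) :
    ∃ g b : E[X], g.Monic ∧ g - b * C c ∈ Ideal.span {f₁, f₂} := by
  have m1 : f₁ ∈ Ideal.span {f₁, f₂} := Ideal.subset_span (by simp)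
  have m2 : f₂ ∈ Ideal.span {f₁, f₂} := Ideal.subset_span (by simp)
  induction c using UniqueFactorizationMonoid.induction_on_prime with
  | h₁ => exact absurd rfl hc
  | h₂ x hx =>
    obtain ⟨y, hy⟩ := hx.exists_left_inv
    refine ⟨1, C y, monic_one, ?_⟩
    rw [← C_mul, hy]; simp
  | h₃ a p ha hp ih =>
    obtain ⟨g, b, hg, hgb⟩ := ih ha
    have : ∃ g' b' : E[X], g'.Monic ∧ g' - b' * C p ∈ Ideal.span {f₁, f₂} := by
      by_cases h : C p ∣ f₁
      · have h2 : ¬ C p ∣ f₂ := fun h2 => hp.not_unit (isUnit_C.1 (hcop h h2))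
        obtain ⟨g', a', b', hm, he⟩ := aux_prime f₂ p hp h2
        refine ⟨g', b', hm, ?_⟩
        rw [he, add_sub_cancel_right]
        exact Ideal.mul_mem_left _ _ m2
      · obtain ⟨g', a', b', hm, he⟩ := aux_prime f₁ p hp h
        refine ⟨g', b', hm, ?_⟩
        rw [he, add_sub_cancel_right]
        exact Ideal.mul_mem_left _ _ m1
    obtain ⟨g', b', hm, he⟩ := this
    refine ⟨g' * g, b' * b, hm.mul hg, ?_⟩
    have : g' * g - b' * b * C (p * a) = g * (g' - b' * C p) + (b' * C p) * (g - b * C a) := by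
      rw [C_mul]; ring
    rw [this]
    exact add_mem (Ideal.mul_mem_left _ _ he) (Ideal.mul_mem_left _ _ hgb)

lemma aux_fin {E : Type*} [CommRing E] [IsDomain E] (I : Ideal E[X]) (g : E[X]) (hg : g.Monic)
    (hgI : g ∈ I) (c : E) (hcI : C c ∈ I) (hfin : Finite (E ⧸ Ideal.span {c})) :
    Finite (E[X] ⧸ I) := by
  have hout : ∀ e : E, ∃ t, e - Quotient.out (Ideal.Quotient.mk (Ideal.span {c}) e) = c * t := by
    intro e
    have : Ideal.Quotient.mk (Ideal.span {c})
        (Quotient.out (Ideal.Quotient.mk (Ideal.span {c}) e)) = Ideal.Quotient.mk _ e :=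
      Ideal.Quotient.mk_out _
    exact Ideal.mem_span_singleton.1 (Ideal.Quotient.eq.1 this.symm)
  let F : (Fin (g.natDegree + 1) → E ⧸ Ideal.span {c}) → E[X] ⧸ I := fun a =>
    Ideal.Quotient.mk I (∑ i, C (Quotient.out (a i)) * X ^ (i : ℕ))
  apply Finite.of_surjective F
  intro y
  obtain ⟨q, rfl⟩ := Ideal.Quotient.mk_surjective y
  refine ⟨fun i => Ideal.Quotient.mk _ ((q %ₘ g).coeff i), ?_⟩
  symm
  rw [Ideal.Quotient.eq]
  have h1 : q %ₘ g = ∑ i : Fin (g.natDegree + 1), C ((q %ₘ g).coeff i) * X ^ (i : ℕ) := by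
    rw [Fin.sum_univ_eq_sum_range (fun i => C ((q %ₘ g).coeff i) * X ^ i)]
    exact as_sum_range_C_mul_X_pow' _ (Nat.lt_succ_of_le (natDegree_modByMonic_le q hg))
  have h2 := modByMonic_add_div q g
  rw [← h2]
  nth_rewrite 1 [h1]
  rw [h2, add_sub_right_comm, ← Finset.sum_sub_distrib]
  refine add_mem (sum_mem fun i _ => ?_) (Ideal.mul_mem_right _ _ hgI)
  obtain ⟨t, ht⟩ := hout ((q %ₘ g).coeff i)
  rw [← sub_mul, ← C_sub, ht, C_mul, mul_assoc]
  exact Ideal.mul_mem_right _ _ hcI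


/-- For a PID `E` and nonzero coprime `f₁, f₂ ∈ E[x]`, the ideal
`(f₁, f₂)` contains a nonzero constant `c ∈ E` and a monic polynomial; and for
any nonzero `c ∈ E` in `(f₁, f₂)`, if `E/(c)` is finite then so is
`E[x]/(f₁, f₂)`. -/
theorem stmt_4 {E : Type*} [CommRing E] [IsDomain E] [IsPrincipalIdealRing E]
    (f₁ f₂ : E[X]) (hf₁ : f₁ ≠ 0) (hf₂ : f₂ ≠ 0) (hcop : IsRelPrime f₁ f₂) :
    (∃ c : E, c ≠ 0 ∧ (C c : E[X]) ∈ Ideal.span {f₁, f₂}) ∧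
    (∃ g : E[X], g.Monic ∧ g ∈ Ideal.span {f₁, f₂}) ∧
    (∀ c : E, c ≠ 0 → (C c : E[X]) ∈ Ideal.span {f₁, f₂} →
      Finite (E ⧸ Ideal.span {c}) →
      Finite (E[X] ⧸ Ideal.span {f₁, f₂})) := by
  obtain ⟨c, hc, hcI⟩ := aux_const f₁ f₂ hf₁ hcop
  obtain ⟨g, b, hg, hgb⟩ := aux_monic f₁ f₂ hcop c hc
  have hgI : g ∈ Ideal.span {f₁, f₂} := by
    have := add_mem hgb (Ideal.mul_mem_left _ b hcI)
    rwa [sub_add_cancel] at this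
  exact ⟨⟨c, hc, hcI⟩, ⟨g, hg, hgI⟩, fun c' _ h hf => aux_fin _ g hg hgI c' h hf⟩
end

section
/- Let E be a principal ideal domain, let f₁, …, f_k ∈ E[x] be pairwise coprime nonconstant polynomials with nonzero constant coefficients such that f₁(0), …, f_k(0) are pairwise coprime in E, and let R ⊆ E[x] be a set of polynomials whose constant coefficients form a complete system of representatives of E modulo f₁(0)⋯f_k(0). Let (V, φ, N) be the simultaneous digit system defined by the f_i and R. Then (V, φ, N) has the Finite Expansion Property if and only if (i) the ideal (f_i, f_j) equals the unit ideal of E[x] for all i ≠ j, and (ii) the polynomial digit system (E[x]/(f₁f₂⋯f_k), X, R) has the Finite Expansion Property, where R is regarded as a set of residue classes modulo f₁⋯f_k. -/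
/-- `(V, φ, D)` is a digit system: `D` is a finite set, the image `φ(V)` has
finite index in `V`, and `D` meets every coset of `φ(V)` in `V`. -/
def IsDigitSystem {V : Type*} [AddCommGroup V] (φ : V →+ V) (D : Set V) : Prop :=
  D.Finite ∧ Finite (V ⧸ φ.range) ∧ ∀ v : V, ∃ d ∈ D, v - d ∈ φ.range

/-- The digit set `D` is irredundant: distinct digits lie in distinct cosets of
`φ(V)`. -/
def IsIrredundant {V : Type*} [AddCommGroup V] (φ : V →+ V) (D : Set V) : Prop :=
  ∀ d₁ ∈ D, ∀ d₂ ∈ D, d₁ - d₂ ∈ φ.range → d₁ = d₂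

/-- The Finite Expansion Property: every `v ∈ V` can be written as
`v = ∑_{i=0}^ℓ φ^i (d i)` with digits `d i ∈ D`. -/
def HasFEP {V : Type*} [AddCommGroup V] (φ : V →+ V) (D : Set V) : Prop :=
  ∀ v : V, ∃ (ℓ : ℕ) (d : ℕ → V), (∀ i ≤ ℓ, d i ∈ D) ∧
    v = ∑ i ∈ Finset.range (ℓ + 1), φ^[i] (d i)

/-- `L` is the zero expansion length of `(V, φ, D)`: `L ≥ 1` is the length of a
shortest digit sequence `(d₀, …, d_{L-1})` with `∑_{i<L} φ^i (d i) = 0`. -/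
def IsZeroExpLength {V : Type*} [AddCommGroup V] (φ : V →+ V) (D : Set V) (L : ℕ) : Prop :=
  0 < L ∧
  (∃ d : ℕ → V, (∀ i < L, d i ∈ D) ∧ ∑ i ∈ Finset.range L, φ^[i] (d i) = 0) ∧
  ∀ L' : ℕ, 0 < L' →
    (∃ d : ℕ → V, (∀ i < L', d i ∈ D) ∧ ∑ i ∈ Finset.range L', φ^[i] (d i) = 0) → L ≤ L'

open Polynomial

theorem hasFEP_iff_aux {E A : Type*} [CommRing E] [CommRing A] (π : E[X] →+* A)
    (ψ : A →+ A) (hψ : ∀ v, ψ v = π X * v) (R : Set E[X]) :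
    HasFEP ψ (π '' R) ↔ ∀ v, ∃ (ℓ : ℕ) (c : ℕ → E[X]), (∀ i ≤ ℓ, c i ∈ R) ∧
      v = π (∑ i ∈ Finset.range (ℓ + 1), X ^ i * c i) := by
  have hit : ∀ (i : ℕ) (c : E[X]), ψ^[i] (π c) = π (X ^ i * c) := by
    intro i c
    induction i with
    | zero => simp
    | succ n ih => rw [Function.iterate_succ_apply', ih, hψ, ← map_mul, pow_succ', mul_assoc]
  unfold HasFEP
  refine forall_congr' fun v => exists_congr fun ℓ => ?_
  constructor
  · rintro ⟨d, hd, hv⟩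
    have : ∀ i, ∃ c, i ≤ ℓ → (c ∈ R ∧ π c = d i) := by
      intro i
      by_cases hi : i ≤ ℓ
      · obtain ⟨c, hc, hcd⟩ := hd i hi
        exact ⟨c, fun _ => ⟨hc, hcd⟩⟩
      · exact ⟨0, fun h => absurd h hi⟩
    choose c hc using this
    refine ⟨c, fun i hi => (hc i hi).1, ?_⟩
    rw [hv, map_sum]
    refine Finset.sum_congr rfl fun i hi => ?_
    rw [← hit, (hc i (Nat.lt_succ_iff.mp (Finset.mem_range.mp hi))).2]
  · rintro ⟨c, hc, hv⟩
    refine ⟨fun i => π (c i), fun i hi => ⟨c i, hc i hi, rfl⟩, ?_⟩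
    rw [hv, map_sum]
    exact Finset.sum_congr rfl fun i _ => (hit i (c i)).symm

/-- The simultaneous digit system defined by pairwise coprime
`f₁, …, f_k ∈ E[x]` (with pairwise coprime nonzero constant coefficients) and a
set `R` of polynomials whose constant coefficients form a complete system of
representatives of `E` modulo `f₁(0)⋯f_k(0)` has the Finite Expansion Property
iff (i) `(fᵢ, fⱼ) = (1)` for all `i ≠ j` and (ii) the polynomial digit system
`(E[x]/(f₁⋯f_k), X, R)` has the Finite Expansion Property. -/
theorem stmt_16 {E : Type*} [CommRing E] [IsDomain E] [IsPrincipalIdealRing E]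
    (k : ℕ) (f : Fin k → E[X])
    (hdeg : ∀ i, 0 < (f i).natDegree)
    (hc : ∀ i, (f i).coeff 0 ≠ 0)
    (hcop : ∀ i j, i ≠ j → IsRelPrime (f i) (f j))
    (hccop : ∀ i j, i ≠ j → IsCoprime ((f i).coeff 0) ((f j).coeff 0))
    (R : Set E[X])
    (hR : ∀ y : E ⧸ Ideal.span {∏ i, (f i).coeff 0},
      ∃! r, r ∈ R ∧ Ideal.Quotient.mk (Ideal.span {∏ i, (f i).coeff 0}) (r.coeff 0) = y)
    (φ : (∀ i, E[X] ⧸ Ideal.span {f i}) →+ (∀ i, E[X] ⧸ Ideal.span {f i}))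
    (hφ : ∀ v i, φ v i = Ideal.Quotient.mk (Ideal.span {f i}) X * v i)
    (N : Set (∀ i, E[X] ⧸ Ideal.span {f i}))
    (hN : N = { v | ∃ c ∈ R, v = fun i => Ideal.Quotient.mk (Ideal.span {f i}) c }) :
    HasFEP φ N ↔
      ((∀ i j, i ≠ j → Ideal.span {f i, f j} = (⊤ : Ideal E[X])) ∧
        HasFEP
          (AddMonoidHom.mulLeft (Ideal.Quotient.mk (Ideal.span {∏ i, f i}) X))
          ((fun c => Ideal.Quotient.mk (Ideal.span {∏ i, f i}) c) '' R)) := by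
  have hN' : N = (RingHom.pi fun i => Ideal.Quotient.mk (Ideal.span {f i})) '' R := by
    rw [hN]
    ext v
    constructor
    · rintro ⟨c, hcR, rfl⟩
      exact ⟨c, hcR, rfl⟩
    · rintro ⟨c, hcR, rfl⟩
      exact ⟨c, hcR, rfl⟩
  rw [hN', hasFEP_iff_aux _ φ (fun v => funext fun i => hφ v i),
    hasFEP_iff_aux (Ideal.Quotient.mk (Ideal.span {∏ i, f i})) _ (fun v => rfl)]
  constructor
  · intro h
    have h1 : ∀ i j, i ≠ j → IsCoprime (f i) (f j) := by
      intro i j hij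
      obtain ⟨ℓ, c, -, hv⟩ := h (Pi.single i 1)
      generalize (∑ i ∈ Finset.range (ℓ + 1), X ^ i * c i) = p at hv
      have hi : Ideal.Quotient.mk (Ideal.span {f i}) 1 = Ideal.Quotient.mk (Ideal.span {f i}) p := by
        have h0 := congrFun hv i
        rw [Pi.single_eq_same] at h0
        exact h0
      have hj : Ideal.Quotient.mk (Ideal.span {f j}) p = 0 := by
        have h0 := congrFun hv j
        rw [Pi.single_eq_of_ne hij.symm] at h0
        exact h0.symm
      rw [Ideal.Quotient.eq, Ideal.mem_span_singleton] at hi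
      rw [Ideal.Quotient.eq_zero_iff_mem, Ideal.mem_span_singleton] at hj
      obtain ⟨a, ha⟩ := hi
      obtain ⟨b, hb⟩ := hj
      exact ⟨a, b, by linear_combination -ha - hb⟩
    refine ⟨fun i j hij => ?_, fun v => ?_⟩
    · rw [Ideal.eq_top_iff_one, Ideal.mem_span_pair]
      exact h1 i j hij
    · obtain ⟨p, rfl⟩ := Ideal.Quotient.mk_surjective v
      obtain ⟨ℓ, c, hcR, hv⟩ := h (RingHom.pi (fun i => Ideal.Quotient.mk (Ideal.span {f i})) p)
      refine ⟨ℓ, c, hcR, ?_⟩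
      rw [Ideal.Quotient.eq, Ideal.mem_span_singleton]
      refine Finset.prod_dvd_of_coprime (fun i _ j _ hij => h1 i j hij) fun i _ => ?_
      rw [← Ideal.mem_span_singleton, ← Ideal.Quotient.eq]
      exact congrFun hv i
  · rintro ⟨h1, h⟩ v
    choose q hq using fun i => Ideal.Quotient.mk_surjective (v i)
    obtain ⟨p, hp⟩ := Ideal.exists_forall_sub_mem_ideal
      (I := fun i => Ideal.span {f i})
      (fun i j hij => by
        change IsCoprime (Ideal.span {f i}) (Ideal.span {f j})
        rw [Ideal.isCoprime_span_singleton_iff]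
        have := h1 i j hij
        rw [Ideal.eq_top_iff_one, Ideal.mem_span_pair] at this
        exact this) q
    obtain ⟨ℓ, c, hcR, hv⟩ := h (Ideal.Quotient.mk _ p)
    refine ⟨ℓ, c, hcR, funext fun i => ?_⟩
    rw [Ideal.Quotient.eq, Ideal.mem_span_singleton] at hv
    have h2 := (Finset.dvd_prod_of_mem f (Finset.mem_univ i)).trans hv
    rw [← Ideal.mem_span_singleton, ← Ideal.Quotient.eq] at h2
    rw [← hq i, ← Ideal.Quotient.eq.mpr (hp i), h2]
    rfl
end

section
/- Let k ≥ 1 and let N₁, …, N_k be pairwise coprime nonzero integers. Let V = ℤ^k, let φ : V → V be (a₁, …, a_k) ↦ (N₁a₁, …, N_k a_k), and let N = { (c, c, …, c) : c = 0, 1, …, |N₁⋯N_k| − 1 } ⊆ V. Then the digit system (V, φ, N) has the Finite Expansion Property if and only if N_i ≤ −2 for all i and either k = 1, or k = 2 and |N₁ − N₂| = 1. -/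
/-- Integer-level form of a finite expansion. -/
def FinExp {k : ℕ} (N : Fin k → ℤ) (P : ℤ) (v : Fin k → ℤ) : Prop :=
  ∃ (n : ℕ) (c : ℕ → ℤ), (∀ j, 0 ≤ c j ∧ c j < P) ∧
    ∀ i, v i = ∑ j ∈ Finset.range n, N i ^ j * c j

theorem iter_apply_aux {k : ℕ} (N : Fin k → ℤ)
    (φ : (Fin k → ℤ) →+ (Fin k → ℤ)) (hφ : ∀ v i, φ v i = N i * v i)
    (j : ℕ) (v : Fin k → ℤ) (i : Fin k) : φ^[j] v i = N i ^ j * v i := by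
  induction j with
  | zero => simp
  | succ j ih => rw [Function.iterate_succ_apply', hφ, ih]; ring

theorem hasFEP_iff_aux_s17 {k : ℕ} (N : Fin k → ℤ)
    (φ : (Fin k → ℤ) →+ (Fin k → ℤ)) (hφ : ∀ v i, φ v i = N i * v i)
    (P : ℤ) (hP : 0 < P) (D : Set (Fin k → ℤ))
    (hD : D = { v | ∃ c : ℤ, 0 ≤ c ∧ c < P ∧ v = fun _ => c }) :
    HasFEP φ D ↔ ∀ v, FinExp N P v := by
  subst hD
  constructor
  · intro h v
    obtain ⟨l, d, hd, hv⟩ := h v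
    have h1 : ∀ j, ∃ c : ℤ, (0 ≤ c ∧ c < P) ∧ (j ≤ l → d j = fun _ => c) := by
      intro j
      by_cases hj : j ≤ l
      · obtain ⟨c, h0, h1, h2⟩ := hd j hj
        exact ⟨c, ⟨h0, h1⟩, fun _ => h2⟩
      · exact ⟨0, ⟨le_refl _, hP⟩, fun h => absurd h hj⟩
    choose c hc hcd using h1
    refine ⟨l + 1, c, hc, fun i => ?_⟩
    rw [hv, Finset.sum_apply]
    refine Finset.sum_congr rfl fun j hj => ?_
    rw [iter_apply_aux N φ hφ, hcd j (by simp at hj; omega)]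
  · intro h v
    obtain ⟨n, c, hc, hv⟩ := h v
    refine ⟨n, fun j => fun _ => if j < n then c j else 0, ?_, ?_⟩
    · intro j _
      by_cases hj : j < n
      · exact ⟨c j, (hc j).1, (hc j).2, by simp [hj]⟩
      · exact ⟨0, le_refl _, hP, by simp [hj]⟩
    · ext i
      rw [Finset.sum_apply, Finset.sum_range_succ, hv i, iter_apply_aux N φ hφ]
      simp only [lt_irrefl, if_false, mul_zero, add_zero]
      refine Finset.sum_congr rfl fun j hj => ?_
      rw [iter_apply_aux N φ hφ, if_pos (Finset.mem_range.1 hj)]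

theorem finExp_step {k : ℕ} (N : Fin k → ℤ) (P : ℤ) (v w : Fin k → ℤ) (c : ℤ)
    (h0 : 0 ≤ c) (h1 : c < P) (hw : FinExp N P w) (hv : ∀ i, v i = c + N i * w i) :
    FinExp N P v := by
  obtain ⟨n, e, he, hw⟩ := hw
  refine ⟨n + 1, fun j => Nat.casesOn j c e, ?_, ?_⟩
  · intro j
    cases j with
    | zero => exact ⟨h0, h1⟩
    | succ j => exact he j
  · intro i
    rw [Finset.sum_range_succ', hv, hw, Finset.mul_sum]
    simp only [pow_zero, one_mul]
    rw [add_comm]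
    congr 1
    refine Finset.sum_congr rfl fun j _ => ?_
    ring

theorem finExp_of_rep {k : ℕ} (N : Fin k → ℤ) (hN : ∀ i, N i ≤ -2) (P : ℤ) (hP : 0 < P)
    (α β γ : ℤ) (hα : 0 ≤ α) (hβ : 0 ≤ β) (hγ : 0 ≤ γ) (hs : α + β + γ = P)
    (hrel : ∀ i, γ * N i ^ 3 + α * N i ^ 2 + β * N i = P) :
    ∀ (n : ℕ) (m : ℕ) (r s t : ℤ), 0 ≤ r → 0 ≤ s → 0 ≤ t → (r + s + t).toNat = n →
      (∑ i, |r + s * N i + t * N i ^ 2|).toNat = m →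
      FinExp N P (fun i => r + s * N i + t * N i ^ 2) := by
  intro n
  induction n using Nat.strong_induction_on with
  | _ n ihn =>
  intro m
  induction m using Nat.strong_induction_on with
  | _ m ihm =>
  intro r s t hr h_s ht hn hm
  have hq : 0 ≤ r / P := Int.ediv_nonneg hr hP.le
  have hc0 : 0 ≤ r % P := Int.emod_nonneg _ hP.ne'
  have hc1 : r % P < P := Int.emod_lt_of_pos _ hP
  have hdiv : r % P + P * (r / P) = r := Int.emod_add_mul_ediv r P
  set q := r / P with hqd
  set c := r % P with hcd
  have hs' : 0 ≤ s + q * β := by positivity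
  have ht' : 0 ≤ t + q * α := by positivity
  have hu' : 0 ≤ q * γ := by positivity
  have hsum : (s + q * β) + (t + q * α) + q * γ = r + s + t - c := by
    rw [← hdiv, ← hs]; ring
  have hv : ∀ i, r + s * N i + t * N i ^ 2 =
      c + N i * ((s + q * β) + (t + q * α) * N i + (q * γ) * N i ^ 2) := by
    intro i
    have := hrel i
    linear_combination (-1) * hdiv - q * this
  by_cases hz : ∀ i, r + s * N i + t * N i ^ 2 = 0
  · exact ⟨0, fun _ => 0, fun _ => ⟨le_refl _, hP⟩, fun i => by simpa using hz i⟩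
  refine finExp_step N P _ (fun i => (s + q * β) + (t + q * α) * N i + (q * γ) * N i ^ 2)
    c hc0 hc1 ?_ hv
  by_cases hcz : c = 0
  · refine ihm _ ?_ _ _ _ hs' ht' hu' (by rw [hsum, hcz, sub_zero, hn]) rfl
    push Not at hz
    obtain ⟨i0, hi0⟩ := hz
    have hpos : 0 < ∑ i, |r + s * N i + t * N i ^ 2| :=
      Finset.sum_pos' (fun i _ => abs_nonneg _) ⟨i0, Finset.mem_univ _, abs_pos.2 hi0⟩
    have hle : 2 * ∑ i, |(s + q * β) + (t + q * α) * N i + (q * γ) * N i ^ 2| ≤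
        ∑ i, |r + s * N i + t * N i ^ 2| := by
      rw [Finset.mul_sum]
      refine Finset.sum_le_sum fun i _ => ?_
      rw [hv i, hcz, zero_add, abs_mul]
      refine mul_le_mul_of_nonneg_right ?_ (abs_nonneg _)
      have := hN i
      rw [abs_of_nonpos (by omega)]
      omega
    have h0 : 0 ≤ ∑ i, |(s + q * β) + (t + q * α) * N i + (q * γ) * N i ^ 2| :=
      Finset.sum_nonneg fun i _ => abs_nonneg _
    omega
  · exact ihn _ (by omega) _ _ _ _ hs' ht' hu' rfl rfl

theorem zero_digits_aux {k : ℕ} (N : Fin k → ℤ) (hNne : ∀ i, N i ≠ 0)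
    (hNcop : ∀ i j, i ≠ j → IsCoprime (N i) (N j)) (i : Fin k) (hi : N i = -1) (n : ℕ) :
    ∀ c : ℕ → ℤ, (∀ j, 0 ≤ c j ∧ c j < |∏ i, N i|) →
      (∀ l, l ≠ i → 0 = ∑ j ∈ Finset.range n, N l ^ j * c j) → ∀ j < n, c j = 0 := by
  induction n with
  | zero => intro c _ _ j hj; omega
  | succ n ih =>
    intro c hc h
    have hdvd : ∏ l, N l ∣ c 0 := by
      refine Finset.prod_dvd_of_coprime (fun a _ b _ hab => hNcop a b hab) ?_
      intro l _
      by_cases hl : l = i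
      · subst hl; rw [hi]; exact ⟨-c 0, by ring⟩
      · have := h l hl
        rw [Finset.sum_range_succ'] at this
        have h2 : N l ∣ ∑ j ∈ Finset.range n, N l ^ (j + 1) * c (j + 1) :=
          Finset.dvd_sum fun j _ => Dvd.dvd.mul_right (dvd_pow_self _ (by omega)) _
        simp only [pow_zero, one_mul] at this
        have h3 : c 0 = -∑ j ∈ Finset.range n, N l ^ (j + 1) * c (j + 1) := by linarith
        rw [h3]; exact (dvd_neg).2 h2
    have hc0 : c 0 = 0 :=
      Int.eq_zero_of_dvd_of_nonneg_of_lt (hc 0).1 (hc 0).2 ((abs_dvd _ _).2 hdvd)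
    have := ih (fun j => c (j + 1)) (fun j => hc (j + 1)) (by
      intro l hl
      have := h l hl
      rw [Finset.sum_range_succ', hc0, mul_zero, add_zero] at this
      have h4 : N l * ∑ j ∈ Finset.range n, N l ^ j * c (j + 1) = 0 := by
        rw [this, Finset.mul_sum]
        exact Finset.sum_congr rfl fun j _ => by ring
      exact ((mul_eq_zero.1 h4).resolve_left (hNne l)).symm)
    intro j hj
    cases j with
    | zero => exact hc0
    | succ j => exact this j (by omega)

theorem stmt_17 (k : ℕ) (hk : 1 ≤ k) (N : Fin k → ℤ)
    (hNne : ∀ i, N i ≠ 0)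
    (hNcop : ∀ i j, i ≠ j → IsCoprime (N i) (N j))
    (φ : (Fin k → ℤ) →+ (Fin k → ℤ))
    (hφ : ∀ v i, φ v i = N i * v i)
    (D : Set (Fin k → ℤ))
    (hD : D = { v | ∃ c : ℤ, 0 ≤ c ∧ c < |∏ i, N i| ∧ v = fun _ => c }) :
    HasFEP φ D ↔
      ((∀ i, N i ≤ -2) ∧
        (k = 1 ∨ (k = 2 ∧ ∀ i j : Fin k, i ≠ j → |N i - N j| = 1))) := by
  have hP : 0 < |∏ i, N i| := abs_pos.2 (Finset.prod_ne_zero_iff.2 fun i _ => hNne i)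
  rw [hasFEP_iff_aux_s17 N φ hφ _ hP D hD]
  constructor
  · intro h
    have hneg : ∀ i, N i ≤ -2 := by
      intro i
      by_contra hcon
      have h0 := hNne i
      by_cases hpos : 0 < N i
      · obtain ⟨n, c, hc, hv⟩ := h (fun _ => -1)
        have h1 := hv i
        have h2 : 0 ≤ ∑ j ∈ Finset.range n, N i ^ j * c j :=
          Finset.sum_nonneg fun j _ => mul_nonneg (pow_nonneg hpos.le _) (hc j).1
        simp only at h1
        omega
      · have hi : N i = -1 := by omega
        obtain ⟨n, c, hc, hv⟩ := h (Pi.single i 1)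
        have hz := zero_digits_aux N hNne hNcop i hi n c hc (fun l hl => by
          rw [← hv l, Pi.single_eq_of_ne hl])
        have h1 := hv i
        rw [Pi.single_eq_same, Finset.sum_eq_zero] at h1
        · omega
        · intro j hj
          rw [hz j (Finset.mem_range.1 hj), mul_zero]
    have hdiff : ∀ i j : Fin k, i ≠ j → |N i - N j| = 1 := by
      intro i j hij
      obtain ⟨n, c, hc, hv⟩ := h (Pi.single i 1)
      have h1 := hv i
      have h2 := hv j
      rw [Pi.single_eq_same] at h1
      rw [Pi.single_eq_of_ne hij.symm] at h2
      have h3 : N i - N j ∣ 1 := by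
        have : (1 : ℤ) = ∑ l ∈ Finset.range n, (N i ^ l - N j ^ l) * c l := by
          simp only [sub_mul, Finset.sum_sub_distrib]
          omega
        rw [this]
        exact Finset.dvd_sum fun l _ => Dvd.dvd.mul_right (sub_dvd_pow_sub_pow _ _ _) _
      exact Int.isUnit_iff_abs_eq.1 (isUnit_of_dvd_one h3)
    refine ⟨hneg, ?_⟩
    have hk2 : k ≤ 2 := by
      by_contra hcon
      have a := hdiff ⟨0, by omega⟩ ⟨1, by omega⟩ (by simp)
      have b := hdiff ⟨0, by omega⟩ ⟨2, by omega⟩ (by simp)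
      have c := hdiff ⟨1, by omega⟩ ⟨2, by omega⟩ (by simp)
      rw [abs_eq (by norm_num)] at a b c
      omega
    rcases (by omega : k = 1 ∨ k = 2) with h1 | h1
    · exact Or.inl h1
    · exact Or.inr ⟨h1, hdiff⟩
  · rintro ⟨hneg, hk1 | ⟨hk2, hdiff⟩⟩ v
    · subst hk1
      have hPe : |∏ i, N i| = -N 0 := by
        have := hneg 0
        simp [abs_of_nonpos (by omega : N 0 ≤ 0)]
      rw [hPe] at hP ⊢
      have hn := hneg 0
      have := finExp_of_rep N hneg (-N 0) hP 1 (-N 0 - 1) 0 (by omega) (by omega) (le_refl _)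
        (by ring) (by intro i; rw [Subsingleton.elim i 0]; ring) _ _
        (v 0 + |v 0| * (-N 0)) |v 0| 0 (by nlinarith [abs_nonneg (v 0), neg_abs_le (v 0)])
        (abs_nonneg _) (le_refl _) rfl rfl
      convert this using 2 with i
      rw [Subsingleton.elim i 0]; ring
    · subst hk2
      have main : ∀ (i0 i1 : Fin 2), i0 ≠ i1 → N i1 = N i0 - 1 → FinExp N |∏ i, N i| v := by
        intro i0 i1 hne h1
        have hcases : ∀ i : Fin 2, i = i0 ∨ i = i1 := by
          intro i; omega
        obtain ⟨m, hm⟩ : ∃ m, N i0 = -m := ⟨-N i0, by ring⟩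
        have hm1 : N i1 = -(m + 1) := by rw [h1, hm]; ring
        have hm2 : 2 ≤ m := by have := hneg i0; omega
        have hPe : |∏ i, N i| = m * (m + 1) := by
          have : ∏ i, N i = m * (m + 1) := by
            rw [Fin.prod_univ_two]
            rcases hcases 0 with h | h <;> rcases hcases 1 with h' | h'
            · rw [← h'] at h; simp at h
            · rw [h, h', hm, hm1]; ring
            · rw [h, h', hm, hm1]; ring
            · rw [← h'] at h; simp at h
          rw [this, abs_of_nonneg (by positivity)]
        rw [hPe] at hP ⊢
        obtain ⟨a, ha⟩ : ∃ a, v i0 = a := ⟨_, rfl⟩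
        obtain ⟨b, hb⟩ : ∃ b, v i1 = b := ⟨_, rfl⟩
        obtain ⟨t, ht⟩ : ∃ t, t = |a - b| + |a + m * (a - b)| := ⟨_, rfl⟩
        have e1 := abs_nonneg (a - b)
        have e2 := abs_nonneg (a + m * (a - b))
        have e3 := neg_abs_le (a - b)
        have e4 := neg_abs_le (a + m * (a - b))
        have := finExp_of_rep N hneg (m * (m + 1)) hP (2 * m) (m * (m + 1) - (2 * m + 1)) 1
          (by omega) (by nlinarith) (by norm_num) (by ring)
          (by
            intro i
            rcases hcases i with h | h
            · rw [h, hm]; ring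
            · rw [h, hm1]; ring) _ _
          (a + m * (a - b) + t * (m ^ 2 + m)) (a - b + t * (2 * m + 1)) t
          (by
            have : t ≤ t * (m ^ 2 + m) := le_mul_of_one_le_right (by omega) (by nlinarith)
            omega)
          (by
            have : t ≤ t * (2 * m + 1) := le_mul_of_one_le_right (by omega) (by omega)
            omega) (by omega) rfl rfl
        convert this using 2 with i
        rcases hcases i with h | h
        · rw [h, hm, ha]; ring
        · rw [h, hm1, hb]; ring
      have hd := hdiff 0 1 (by simp)
      rw [abs_eq (by norm_num)] at hd
      rcases hd with hd | hd
      · exact main 0 1 (by simp) (by omega)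
      · exact main 1 0 (by simp) (by omega)
end

section
/- Let k ≥ 1 and let N₁, …, N_k ∈ ℤ be pairwise coprime integers with N_j ≤ −2 for all j. If the polynomial ∏_{j=1}^k (x − N_j) is a CNS polynomial, then every integer a admits a finite simultaneous expansion: there exist ℓ ≥ 0 and digits d₀, …, d_ℓ ∈ {0, 1, …, |N₁⋯N_k| − 1} such that a = Σ_{i=0}^ℓ d_i N_j^i holds for every j = 1, …, k. In particular, this conclusion holds whenever k ≤ 4. -/
open Polynomial

/-- A monic polynomial `f ∈ ℤ[x]` is a CNS polynomial if every element of
`ℤ[x]/(f)` has a finite expansion `∑ dᵢ Xⁱ` with digits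
`dᵢ ∈ {0, 1, …, |f(0)| - 1}`. -/
def IsCNS (f : ℤ[X]) : Prop :=
  f.Monic ∧ ∀ g : ℤ[X] ⧸ Ideal.span {f}, ∃ (ℓ : ℕ) (d : ℕ → ℤ),
    (∀ i ≤ ℓ, 0 ≤ d i ∧ d i < |f.coeff 0|) ∧
    g = ∑ i ∈ Finset.range (ℓ + 1),
      Ideal.Quotient.mk (Ideal.span {f}) (C (d i) * X ^ i)

lemma n_bound (S p n : ℤ) (hp : 0 < p) (h1 : S ≤ 2 * p) (h2 : -(2 * p) ≤ S)
    (hl : -p < S + p * n) (hu : S + p * n < p) : -2 ≤ n ∧ n ≤ 2 := by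
  constructor
  · have : p * (-3) < p * n := by linarith
    have := lt_of_mul_lt_mul_left this hp.le
    omega
  · have : p * n < p * 3 := by linarith
    have := lt_of_mul_lt_mul_left this hp.le
    omega

/-- Finite witness set, layered by the length of the backward-division orbit. -/
def layersK : List (List (ℤ × ℤ × ℤ × ℤ)) :=
  [[(0, 0, 0, 0)],
   [(1, 0, 0, 0)],
   [(-1, 1, 0, 0), (0, 1, 0, 0)],
   [(-1, 0, 1, 0), (0, -1, 1, 0), (0, 0, 1, 0), (1, -1, 1, 0)],
   [(-1, 0, 0, 1), (-1, 1, -1, 1), (0, -1, 0, 1), (0, 0, -1, 1), (0, 0, 0, 1), (0, 1, -1, 1), (1, -1, 0, 1), (1, 0, -1, 1)],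
   [(-1, 0, 0, 0), (0, 0, 0, -1)],
   [(0, -1, 0, 0), (1, -1, 0, 0)],
   [(-1, 1, -1, 0), (0, 0, -1, 0), (0, 1, -1, 0), (1, 0, -1, 0)],
   [(-1, 0, 1, -1), (-1, 1, 0, -1), (0, -1, 1, -1), (0, 0, 1, -1), (0, 1, 0, -1), (1, -1, 1, -1), (1, 0, 0, -1)]]

def rkK (z : ℤ × ℤ × ℤ × ℤ) : ℕ := layersK.findIdx (fun l => l.contains z)

set_option maxHeartbeats 4000000 in
lemma stepK (p0 p1 p2 p3 p4 : ℤ) (h4 : 0 ≤ p4) (h3 : p4 ≤ p3) (h2 : p3 ≤ p2) (h1 : p2 ≤ p1) (h0 : p1 < p0) (hp1 : 0 < p1)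
    (a b c e : ℤ) (h : (a, b, c, e) ∈ layersK.flatten) (n : ℤ)
    (hl : -p0 < p4 * a + p3 * b + p2 * c + p1 * e + p0 * n)
    (hu : p4 * a + p3 * b + p2 * c + p1 * e + p0 * n < p0) :
    (b, c, e, n) ∈ layersK.flatten ∧
      (0 ≤ p4 * a + p3 * b + p2 * c + p1 * e + p0 * n →
        rkK (b, c, e, n) < rkK (a, b, c, e) ∨ (a, b, c, e) = (0, 0, 0, 0)) := by
  simp only [layersK, List.flatten_cons, List.flatten_nil, List.cons_append, List.nil_append,
    List.mem_cons, List.not_mem_nil, or_false, Prod.mk.injEq] at h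
  rcases h with
      h | h | h | h | h | h | h | h | h | h | h | h | h | h | h | h | h | h | h | h | 
      h | h | h | h | h | h | h | h | h | h | h
  all_goals
    obtain ⟨rfl, rfl, rfl, rfl⟩ := h
    obtain ⟨hn1, hn2⟩ := n_bound _ p0 n (by omega) (by omega) (by omega) hl hu
    interval_cases n
    all_goals first
      | (exfalso; omega)
      | exact ⟨by decide, fun _ => by decide⟩
      | exact ⟨by decide, fun h => by exfalso; omega⟩

/-- Finite witness set, layered by the length of the backward-division orbit. -/
def layersB : List (List (ℤ × ℤ × ℤ × ℤ)) :=
  [[(0, 0, 0, 0)],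
   [(1, 0, 0, 0)],
   [(-2, 1, 0, 0), (-1, 1, 0, 0), (0, 1, 0, 0)],
   [(-1, 0, 1, 0), (0, -1, 1, 0), (0, 0, 1, 0), (1, -2, 1, 0), (1, -1, 1, 0), (2, -2, 1, 0), (2, -1, 1, 0)],
   [(-2, 1, -1, 1), (-2, 2, -2, 1), (-2, 2, -1, 1), (-1, 1, -1, 1), (-1, 2, -2, 1), (-1, 2, -1, 1), (0, 0, -1, 1), (0, 1, -2, 1), (0, 1, -1, 1), (1, 0, -1, 1)],
   [(-1, 0, 1, -1), (0, -1, 1, -1), (0, -1, 2, -1), (0, 0, 1, -1), (1, -2, 1, -1), (1, -2, 2, -1), (1, -1, 1, -1), (2, -2, 1, -1), (2, -2, 2, -1), (2, -1, 1, -1)],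
   [(-2, 2, -2, 2), (-1, 0, 0, 1), (-1, 2, -2, 2), (0, -1, 0, 1), (0, 0, -1, 2), (0, 0, 0, 1), (0, 1, -2, 2), (1, -1, 0, 1), (1, 0, -1, 2), (2, -1, 0, 1)],
   [(-2, 1, -1, 0), (-2, 1, 0, -1), (-2, 2, -1, 0), (-1, 0, 0, 0), (-1, 0, 1, -2), (-1, 1, -1, 0), (-1, 1, 0, -1), (-1, 2, -1, 0), (0, -1, 0, 0), (0, -1, 2, -2), (0, 0, -1, 0), (0, 0, 0, -1), (0, 0, 1, -2), (0, 1, -1, 0), (0, 1, 0, -1), (1, -2, 2, -2), (1, -1, 0, 0), (1, 0, -1, 0), (1, 0, 0, -1), (2, -2, 2, -2), (2, -1, 0, 0)]]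

def rkB (z : ℤ × ℤ × ℤ × ℤ) : ℕ := layersB.findIdx (fun l => l.contains z)

set_option maxHeartbeats 4000000 in
lemma stepB (t s q : ℤ) (ht : 0 ≤ t) (hs : 12 * t ≤ s) (hs0 : 0 < s) (hq : 5 * s - 25 * t ≤ q)
    (a b c e : ℤ) (h : (a, b, c, e) ∈ layersB.flatten) (n : ℤ)
    (hl : -(6 * q) < t * a + (5 * t + s) * b + (q + 5 * s + 6 * t) * c + (5 * q + 6 * s) * e + (6 * q) * n)
    (hu : t * a + (5 * t + s) * b + (q + 5 * s + 6 * t) * c + (5 * q + 6 * s) * e + (6 * q) * n < (6 * q)) :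
    (b, c, e, n) ∈ layersB.flatten ∧
      (0 ≤ t * a + (5 * t + s) * b + (q + 5 * s + 6 * t) * c + (5 * q + 6 * s) * e + (6 * q) * n →
        rkB (b, c, e, n) < rkB (a, b, c, e) ∨ (a, b, c, e) = (0, 0, 0, 0)) := by
  simp only [layersB, List.flatten_cons, List.flatten_nil, List.cons_append, List.nil_append,
    List.mem_cons, List.not_mem_nil, or_false, Prod.mk.injEq] at h
  rcases h with
      h | h | h | h | h | h | h | h | h | h | h | h | h | h | h | h | h | h | h | h | 
      h | h | h | h | h | h | h | h | h | h | h | h | h | h | h | h | h | h | h | h | 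
      h | h | h | h | h | h | h | h | h | h | h | h | h | h | h | h | h | h | h | h | 
      h | h | h
  all_goals
    obtain ⟨rfl, rfl, rfl, rfl⟩ := h
    obtain ⟨hn1, hn2⟩ := n_bound _ (6 * q) n (by omega) (by omega) (by omega) hl hu
    interval_cases n
    all_goals first
      | (exfalso; omega)
      | exact ⟨by decide, fun _ => by decide⟩
      | exact ⟨by decide, fun h => by exfalso; omega⟩

/-- States reaching zero under backward division. -/
inductive ZRep (p0 p1 p2 p3 p4 : ℤ) : ℤ → ℤ → ℤ → ℤ → Prop
  | zero : ZRep p0 p1 p2 p3 p4 0 0 0 0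
  | step (a b c e n : ℤ) : 0 ≤ p4 * a + p3 * b + p2 * c + p1 * e + p0 * n →
      p4 * a + p3 * b + p2 * c + p1 * e + p0 * n < p0 → ZRep p0 p1 p2 p3 p4 b c e n →
      ZRep p0 p1 p2 p3 p4 a b c e

lemma exists_digit (p s : ℤ) (hp : 0 < p) : ∃ m : ℤ, 0 ≤ s + p * m ∧ s + p * m < p := by
  refine ⟨-(s / p), ?_, ?_⟩
  · have := Int.emod_nonneg s hp.ne'
    rw [Int.emod_def] at this; linarith
  · have := Int.emod_lt_of_pos s hp
    rw [Int.emod_def] at this; linarith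

lemma ZRep.add {p0 p1 p2 p3 p4 : ℤ} (hp : 0 < p0) (V : ℤ × ℤ × ℤ × ℤ → Prop)
    (hV : ∀ a b c e n, V (a, b, c, e) → -p0 < p4 * a + p3 * b + p2 * c + p1 * e + p0 * n →
      p4 * a + p3 * b + p2 * c + p1 * e + p0 * n < p0 → V (b, c, e, n))
    (hR : ∀ a b c e, V (a, b, c, e) → ZRep p0 p1 p2 p3 p4 a b c e)
    {a b c e : ℤ} (h : ZRep p0 p1 p2 p3 p4 a b c e) :
    ∀ a' b' c' e', V (a', b', c', e') →
      ZRep p0 p1 p2 p3 p4 (a + a') (b + b') (c + c') (e + e') := by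
  induction h with
  | zero => intro a' b' c' e' hv; simpa using hR _ _ _ _ hv
  | step a b c e n h0 h1 _ ih =>
    intro a' b' c' e' hv
    obtain ⟨m, hm0, hm1⟩ := exists_digit p0 ((p4 * a + p3 * b + p2 * c + p1 * e + p0 * n) +
      (p4 * a' + p3 * b' + p2 * c' + p1 * e')) hp
    refine ZRep.step _ _ _ _ (n + m) ?_ ?_ (ih _ _ _ _ (hV a' b' c' e' m hv ?_ ?_))
    · linarith
    · linarith
    · linarith
    · linarith

lemma ZRep.value {p0 p1 p2 p3 p4 : ℤ} (hp : 0 < p0)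
    {a b c e : ℤ} (h : ZRep p0 p1 p2 p3 p4 a b c e) :
    ∃ (ℓ : ℕ) (d : ℕ → ℤ), (∀ i ≤ ℓ, 0 ≤ d i ∧ d i < p0) ∧
      ∀ x : ℤ, p4 * x ^ 4 + p3 * x ^ 3 + p2 * x ^ 2 + p1 * x + p0 = 0 →
        a * p4 + b * (p4 * x + p3) + c * (p4 * x ^ 2 + p3 * x + p2) +
          e * (p4 * x ^ 3 + p3 * x ^ 2 + p2 * x + p1) =
        ∑ i ∈ Finset.range (ℓ + 1), d i * x ^ i := by
  induction h with
  | zero => exact ⟨0, fun _ => 0, fun i _ => ⟨le_rfl, hp⟩, fun x _ => by simp⟩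
  | step a b c e n h0 h1 _ ih =>
    obtain ⟨l, d, hd, hx⟩ := ih
    refine ⟨l + 1, fun i => Nat.casesOn i
      (p4 * a + p3 * b + p2 * c + p1 * e + p0 * n) d, ?_, ?_⟩
    · intro i hi
      cases i with
      | zero => exact ⟨h0, h1⟩
      | succ i => exact hd i (by omega)
    · intro x hf
      rw [Finset.sum_range_succ']
      have h2 := hx x hf
      have h3 : ∑ i ∈ Finset.range (l + 1), d i * x ^ (i + 1) =
          (∑ i ∈ Finset.range (l + 1), d i * x ^ i) * x := by
        rw [Finset.sum_mul]; exact Finset.sum_congr rfl fun i _ => by ring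
      simp only [h3, ← h2]
      show _ = _ + (p4 * a + p3 * b + p2 * c + p1 * e + p0 * n) * x ^ 0
      linear_combination (-n) * hf

/-- Combination: a witness set with a rank makes all multiples of a unit state representable. -/
lemma ZRep.multiples {p0 p1 p2 p3 p4 : ℤ} (hp : 0 < p0) (V : ℤ × ℤ × ℤ × ℤ → Prop)
    (rk : ℤ × ℤ × ℤ × ℤ → ℕ)
    (hV : ∀ a b c e, V (a, b, c, e) → ∀ n, -p0 < p4 * a + p3 * b + p2 * c + p1 * e + p0 * n →
      p4 * a + p3 * b + p2 * c + p1 * e + p0 * n < p0 → V (b, c, e, n) ∧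
      (0 ≤ p4 * a + p3 * b + p2 * c + p1 * e + p0 * n →
        rk (b, c, e, n) < rk (a, b, c, e) ∨ (a, b, c, e) = (0, 0, 0, 0)))
    (a b c e : ℤ) (h1 : V (a, b, c, e)) (h2 : V (-a, -b, -c, -e)) (m : ℤ) :
    ZRep p0 p1 p2 p3 p4 (m * a) (m * b) (m * c) (m * e) := by
  have hR : ∀ r a b c e, rk (a, b, c, e) < r → V (a, b, c, e) → ZRep p0 p1 p2 p3 p4 a b c e := by
    intro r
    induction r with
    | zero => intro a b c e h; omega
    | succ r ih =>
      intro a b c e h hv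
      obtain ⟨n, hn0, hn1⟩ := exists_digit p0 (p4 * a + p3 * b + p2 * c + p1 * e) hp
      obtain ⟨hv', hr⟩ := hV a b c e hv n (by linarith) hn1
      rcases hr hn0 with hr | hr
      · exact ZRep.step a b c e n hn0 hn1 (ih _ _ _ _ (by omega) hv')
      · simp only [Prod.mk.injEq] at hr
        obtain ⟨rfl, rfl, rfl, rfl⟩ := hr
        exact ZRep.zero
  have hadd : ∀ {a b c e : ℤ}, ZRep p0 p1 p2 p3 p4 a b c e → ∀ a' b' c' e', V (a', b', c', e') →
      ZRep p0 p1 p2 p3 p4 (a + a') (b + b') (c + c') (e + e') := fun h =>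
    ZRep.add hp V (fun a b c e n hv hl hu => (hV a b c e hv n hl hu).1)
      (fun a b c e hv => hR _ a b c e (Nat.lt_succ_self _) hv) h
  induction m using Int.induction_on with
  | zero => simpa using ZRep.zero
  | succ i ih => simpa [add_mul] using hadd ih _ _ _ _ h1
  | pred i ih => simpa [sub_mul, ← sub_eq_add_neg] using hadd ih _ _ _ _ h2

/-- The target: simultaneous expansions. -/
def SimExp (k : ℕ) (N : Fin k → ℤ) : Prop :=
  ∀ a : ℤ, ∃ (ℓ : ℕ) (d : ℕ → ℤ),
        (∀ i ≤ ℓ, 0 ≤ d i ∧ d i < |∏ j, N j|) ∧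
        ∀ j, a = ∑ i ∈ Finset.range (ℓ + 1), d i * N j ^ i

lemma SimExp.perm {k : ℕ} {N : Fin k → ℤ} (σ : Equiv.Perm (Fin k)) (h : SimExp k (N ∘ σ)) :
    SimExp k N := by
  intro a
  obtain ⟨l, d, hd, hx⟩ := h a
  have : ∏ j, (N ∘ σ) j = ∏ j, N j := Equiv.prod_comp σ N
  rw [this] at hd
  refine ⟨l, d, hd, fun j => ?_⟩
  simpa using hx (σ.symm j)

lemma SimExp.of_rep {k : ℕ} {N : Fin k → ℤ} {p0 p1 p2 p3 p4 : ℤ} (hp : 0 < p0)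
    (hprod : |∏ j, N j| = p0)
    (hroot : ∀ j, p4 * N j ^ 4 + p3 * N j ^ 3 + p2 * N j ^ 2 + p1 * N j + p0 = 0)
    (a b c e : ℤ) (hR : ∀ m, ZRep p0 p1 p2 p3 p4 (m * a) (m * b) (m * c) (m * e))
    (h1 : ∀ x, a * p4 + b * (p4 * x + p3) + c * (p4 * x ^ 2 + p3 * x + p2) +
          e * (p4 * x ^ 3 + p3 * x ^ 2 + p2 * x + p1) = 1) : SimExp k N := by
  intro m
  obtain ⟨l, d, hd, hx⟩ := (hR m).value hp
  refine ⟨l, d, by rwa [hprod], fun j => ?_⟩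
  rw [← hx _ (hroot j)]
  linear_combination (-m) * h1 (N j)

lemma part_one {k : ℕ} {N : Fin k → ℤ} (h : IsCNS (∏ j, (X - C (N j)))) : SimExp k N := by
  intro a
  obtain ⟨l, d, hd, hx⟩ := h.2 (Ideal.Quotient.mk _ (C a))
  have h0 : |(∏ j, (X - C (N j))).coeff 0| = |∏ j, N j| := by
    rw [Polynomial.coeff_zero_eq_eval_zero, Polynomial.eval_prod, Finset.abs_prod, Finset.abs_prod]
    simp
  rw [h0] at hd
  refine ⟨l, d, hd, fun j => ?_⟩
  rw [← map_sum, Ideal.Quotient.eq, Ideal.mem_span_singleton] at hx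
  have h1 : (X - C (N j)) ∣ C a - ∑ i ∈ Finset.range (l + 1), C (d i) * X ^ i :=
    (Finset.dvd_prod_of_mem (fun j => X - C (N j)) (Finset.mem_univ j)).trans hx
  rw [Polynomial.dvd_iff_isRoot, Polynomial.IsRoot.def, Polynomial.eval_sub,
    Polynomial.eval_finsetSum] at h1
  simp at h1
  linarith

lemma simExpK {k : ℕ} {N : Fin k → ℤ} (p0 p1 p2 p3 p4 : ℤ) (h4 : 0 ≤ p4) (h3 : p4 ≤ p3)
    (h2 : p3 ≤ p2) (h1 : p2 ≤ p1) (h0 : p1 < p0) (hp1 : 0 < p1)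
    (hprod : |∏ j, N j| = p0)
    (hroot : ∀ j, p4 * N j ^ 4 + p3 * N j ^ 3 + p2 * N j ^ 2 + p1 * N j + p0 = 0)
    (a b c e : ℤ) (hm : (a, b, c, e) ∈ layersK.flatten)
    (hm' : (-a, -b, -c, -e) ∈ layersK.flatten)
    (hx : ∀ x, a * p4 + b * (p4 * x + p3) + c * (p4 * x ^ 2 + p3 * x + p2) +
          e * (p4 * x ^ 3 + p3 * x ^ 2 + p2 * x + p1) = 1) : SimExp k N :=
  SimExp.of_rep (by omega) hprod hroot a b c e
    (ZRep.multiples (by omega) (fun z => z ∈ layersK.flatten) rkK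
      (fun a b c e h n hl hu => stepK p0 p1 p2 p3 p4 h4 h3 h2 h1 h0 hp1 a b c e h n hl hu)
      a b c e hm hm') hx

lemma simExpB {k : ℕ} {N : Fin k → ℤ} (t s q : ℤ) (ht : 0 ≤ t) (hs : 12 * t ≤ s) (hs0 : 0 < s)
    (hq : 5 * s - 25 * t ≤ q)
    (hprod : |∏ j, N j| = 6 * q)
    (hroot : ∀ j, t * N j ^ 4 + (5 * t + s) * N j ^ 3 + (q + 5 * s + 6 * t) * N j ^ 2 +
      (5 * q + 6 * s) * N j + 6 * q = 0)
    (a b c e : ℤ) (hm : (a, b, c, e) ∈ layersB.flatten)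
    (hm' : (-a, -b, -c, -e) ∈ layersB.flatten)
    (hx : ∀ x, a * t + b * (t * x + (5 * t + s)) +
          c * (t * x ^ 2 + (5 * t + s) * x + (q + 5 * s + 6 * t)) +
          e * (t * x ^ 3 + (5 * t + s) * x ^ 2 + (q + 5 * s + 6 * t) * x + (5 * q + 6 * s)) = 1) :
    SimExp k N :=
  SimExp.of_rep (by omega) hprod hroot a b c e
    (ZRep.multiples (by omega) (fun z => z ∈ layersB.flatten) rkB
      (fun a b c e h n hl hu => stepB t s q ht hs hs0 hq a b c e h n hl hu)
      a b c e hm hm') hx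

lemma case1 (N : Fin 1 → ℤ) (h : ∀ j, N j ≤ -2) : SimExp 1 N := by
  have h0 := h 0
  refine simExpK (-N 0) 1 0 0 0 (by omega) (by omega) (by omega) (by omega) (by omega) (by omega)
    ?_ ?_ 0 0 0 1 (by decide) (by decide) (by intro x; ring)
  · simp only [Fin.prod_univ_one]; rw [abs_of_neg (by omega)]
  · intro j; fin_cases j; simp

lemma case2 (N : Fin 2 → ℤ) (a b : ℤ) (ha : N 0 = -a) (hb : N 1 = -b) (h2 : 2 ≤ a) (hab : a < b) :
    SimExp 2 N := by
  refine simExpK (a * b) (a + b) 1 0 0 (by omega) (by omega) (by omega) (by omega) (by nlinarith)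
    (by omega) ?_ ?_ 0 0 1 0 (by decide) (by decide) (by intro x; ring)
  · rw [Fin.prod_univ_two, ha, hb, abs_of_pos (by nlinarith)]; ring
  · intro j; fin_cases j
    · simp only [Fin.zero_eta, ha]; ring
    · simp only [Fin.mk_one, hb]; ring

lemma three_lt (a b c A B C : ℤ) (hA : a = A + 3) (hB : b = B + 4) (hC : c = C + 5)
    (h1 : 0 ≤ A) (h2 : 0 ≤ B) (h3 : 0 ≤ C) :
    a * b + a * c + b * c < a * b * c := by
  subst hA hB hC
  rw [← sub_pos]
  ring_nf
  positivity

lemma three_lt' (a b c A B C : ℤ) (hA : a = A + 2) (hB : b = B + 5) (hC : c = C + 7)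
    (h1 : 0 ≤ A) (h2 : 0 ≤ B) (h3 : 0 ≤ C) :
    a * b + a * c + b * c < a * b * c := by
  subst hA hB hC
  rw [← sub_pos]
  ring_nf
  positivity

lemma four_lt (a b c d A B C D : ℤ) (hA : a = A + 3) (hB : b = B + 4) (hC : c = C + 5)
    (hD : d = D + 6)
    (h1 : 0 ≤ A) (h2 : 0 ≤ B) (h3 : 0 ≤ C) (h4 : 0 ≤ D) :
    a * b * c + a * b * d + a * c * d + b * c * d < a * b * c * d := by
  subst hA hB hC hD
  rw [← sub_pos]
  ring_nf
  positivity

lemma four_lt' (a b c d A B C D : ℤ) (hA : a = A + 2) (hB : b = B + 5) (hC : c = C + 7)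
    (hD : d = D + 9)
    (h1 : 0 ≤ A) (h2 : 0 ≤ B) (h3 : 0 ≤ C) (h4 : 0 ≤ D) :
    a * b * c + a * b * d + a * c * d + b * c * d < a * b * c * d := by
  subst hA hB hC hD
  rw [← sub_pos]
  ring_nf
  positivity

lemma four_mono (a b c d A B C D : ℤ) (hA : a = A + 2) (hB : b = B + 2) (hC : c = C + 2)
    (hD : d = D + 2)
    (h1 : 0 ≤ A) (h2 : 0 ≤ B) (h3 : 0 ≤ C) (h4 : 0 ≤ D) :
    a * b + a * c + a * d + b * c + b * d + c * d <
      a * b * c + a * b * d + a * c * d + b * c * d ∧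
    a + b + c + d < a * b + a * c + a * d + b * c + b * d + c * d := by
  subst hA hB hC hD
  constructor
  · rw [← sub_pos]
    ring_nf
    positivity
  · rw [← sub_pos]
    ring_nf
    positivity

lemma case3 (N : Fin 3 → ℤ) (a b c : ℤ) (ha : N 0 = -a) (hb : N 1 = -b) (hc : N 2 = -c)
    (h2 : 2 ≤ a) (hab : a < b) (hbc : b < c)
    (hodd : a = 2 → b % 2 = 1 ∧ c % 2 = 1) : SimExp 3 N := by
  have hprod : |∏ j, N j| = a * b * c := by
    have : 0 < a * b * c := by
      have : 0 < a := by omega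
      have : 0 < b := by omega
      have : 0 < c := by omega
      positivity
    rw [Fin.prod_univ_three, ha, hb, hc, show -a * -b * -c = -(a * b * c) by ring, abs_neg,
      abs_of_pos this]
  by_cases h : a = 2 ∧ b = 3
  · obtain ⟨rfl, rfl⟩ := h
    have := hodd rfl
    refine simExpB 0 1 c (by omega) (by omega) (by omega) (by omega) (by rw [hprod]; ring) ?_
      0 1 0 0 (by decide) (by decide) (by intro x; ring)
    intro j; fin_cases j
    · simp only [Fin.zero_eta, ha]; ring
    · simp only [Fin.mk_one, hb]; ring
    · simp only [Fin.reduceFinMk, hc]; ring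
  · have hlt : a * b + a * c + b * c < a * b * c := by
      by_cases h' : a = 2
      · have := hodd h'
        exact three_lt' a b c (a - 2) (b - 5) (c - 7) (by ring) (by ring) (by ring) (by omega)
          (by omega) (by omega)
      · exact three_lt a b c (a - 3) (b - 4) (c - 5) (by ring) (by ring) (by ring) (by omega)
          (by omega) (by omega)
    refine simExpK (a * b * c) (a * b + a * c + b * c) (a + b + c) 1 0 (by omega) (by omega)
      (by omega) (by nlinarith) hlt (by nlinarith) hprod ?_
      0 1 0 0 (by decide) (by decide) (by intro x; ring)
    intro j; fin_cases j
    · simp only [Fin.zero_eta, ha]; ring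
    · simp only [Fin.mk_one, hb]; ring
    · simp only [Fin.reduceFinMk, hc]; ring

lemma case4 (N : Fin 4 → ℤ) (a b c d : ℤ) (ha : N 0 = -a) (hb : N 1 = -b) (hc : N 2 = -c)
    (hd : N 3 = -d)
    (h2 : 2 ≤ a) (hab : a < b) (hbc : b < c) (hcd : c < d)
    (hodd : a = 2 → b % 2 = 1 ∧ c % 2 = 1 ∧ d % 2 = 1) : SimExp 4 N := by
  have hprod : |∏ j, N j| = a * b * c * d := by
    have : 0 < a * b * c * d := by
      have : 0 < a := by omega
      have : 0 < b := by omega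
      have : 0 < c := by omega
      have : 0 < d := by omega
      positivity
    rw [Fin.prod_univ_four, ha, hb, hc, hd, show -a * -b * -c * -d = a * b * c * d by ring,
      abs_of_pos this]
  by_cases h : a = 2 ∧ b = 3
  · obtain ⟨rfl, rfl⟩ := h
    have := hodd rfl
    refine simExpB 1 (c + d) (c * d) (by omega) (by omega) (by omega)
      (by nlinarith [mul_nonneg (show 0 ≤ c - 5 by omega) (show 0 ≤ d - 5 by omega)])
      (by rw [hprod]; ring) ?_
      1 0 0 0 (by decide) (by decide) (by intro x; ring)
    intro j; fin_cases j
    · simp only [Fin.zero_eta, ha]; ring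
    · simp only [Fin.mk_one, hb]; ring
    · simp only [Fin.reduceFinMk, hc]; ring
    · simp only [Fin.reduceFinMk, hd]; ring
  · have hlt : a * b * c + a * b * d + a * c * d + b * c * d < a * b * c * d := by
      by_cases h' : a = 2
      · have := hodd h'
        exact four_lt' a b c d (a - 2) (b - 5) (c - 7) (d - 9) (by ring) (by ring) (by ring)
          (by ring) (by omega) (by omega) (by omega) (by omega)
      · exact four_lt a b c d (a - 3) (b - 4) (c - 5) (d - 6) (by ring) (by ring) (by ring)
          (by ring) (by omega) (by omega) (by omega) (by omega)
    obtain ⟨hm1, hm2⟩ := four_mono a b c d (a - 2) (b - 2) (c - 2) (d - 2) (by ring) (by ring)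
      (by ring) (by ring) (by omega) (by omega) (by omega) (by omega)
    refine simExpK (a * b * c * d) (a * b * c + a * b * d + a * c * d + b * c * d)
      (a * b + a * c + a * d + b * c + b * d + c * d) (a + b + c + d) 1 (by omega) (by omega)
      hm2.le hm1.le hlt (by linarith) hprod ?_
      1 0 0 0 (by decide) (by decide) (by intro x; ring)
    intro j; fin_cases j
    · simp only [Fin.zero_eta, ha]; ring
    · simp only [Fin.mk_one, hb]; ring
    · simp only [Fin.reduceFinMk, hc]; ring
    · simp only [Fin.reduceFinMk, hd]; ring

lemma ne_of_coprime {a b : ℤ} (h : IsCoprime a b) (ha : a ≤ -2) : a ≠ b := by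
  rintro rfl
  rw [isCoprime_self, Int.isUnit_iff] at h
  omega

lemma odd_of_coprime {a b : ℤ} (h : IsCoprime a b) (ha : a = -2) : (-b) % 2 = 1 := by
  subst ha
  obtain ⟨u, v, h⟩ := h
  by_contra hb
  obtain ⟨w, rfl⟩ : ∃ w, b = 2 * w := ⟨b / 2, by omega⟩
  have : 2 * (v * w - u) = 1 := by linarith
  omega

lemma sorted_case (k : ℕ) (hk : 1 ≤ k) (h4 : k ≤ 4) (N : Fin k → ℤ) (hle : ∀ j, N j ≤ -2)
    (hcop : ∀ i j, i ≠ j → IsCoprime (N i) (N j)) (hanti : Monotone (fun j => -N j)) :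
    SimExp k N := by
  have hlt : ∀ i j, i < j → -N i < -N j := fun i j hij =>
    lt_of_le_of_ne (hanti hij.le) fun h => ne_of_coprime (hcop i j hij.ne) (hle i) (by omega)
  have hodd : ∀ i j, i < j → -N i = 2 → (-N j) % 2 = 1 := fun i j hij h =>
    odd_of_coprime (hcop i j hij.ne) (by omega)
  interval_cases k
  · exact case1 N hle
  · have := hle 0
    exact case2 N (-N 0) (-N 1) (by ring) (by ring) (by omega) (hlt 0 1 (by decide))
  · have := hle 0
    exact case3 N (-N 0) (-N 1) (-N 2) (by ring) (by ring) (by ring) (by omega)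
      (hlt 0 1 (by decide)) (hlt 1 2 (by decide))
      fun h => ⟨hodd 0 1 (by decide) h, hodd 0 2 (by decide) h⟩
  · have := hle 0
    exact case4 N (-N 0) (-N 1) (-N 2) (-N 3) (by ring) (by ring) (by ring) (by ring) (by omega)
      (hlt 0 1 (by decide)) (hlt 1 2 (by decide)) (hlt 2 3 (by decide))
      fun h => ⟨hodd 0 1 (by decide) h, hodd 0 2 (by decide) h, hodd 0 3 (by decide) h⟩

/-- If `N₁, …, N_k` are pairwise coprime integers `≤ -2` and
`∏ⱼ (x - Nⱼ)` is a CNS polynomial, then every integer has a finite simultaneous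
expansion with digits in `{0, …, |N₁⋯N_k| - 1}` valid in every base `Nⱼ`
at once; in particular this holds whenever `k ≤ 4`. -/
theorem stmt_18 (k : ℕ) (hk : 1 ≤ k) (N : Fin k → ℤ)
    (hle : ∀ j, N j ≤ -2)
    (hcop : ∀ i j, i ≠ j → IsCoprime (N i) (N j)) :
    (IsCNS (∏ j, (X - C (N j))) →
      ∀ a : ℤ, ∃ (ℓ : ℕ) (d : ℕ → ℤ),
        (∀ i ≤ ℓ, 0 ≤ d i ∧ d i < |∏ j, N j|) ∧
        ∀ j, a = ∑ i ∈ Finset.range (ℓ + 1), d i * N j ^ i) ∧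
    (k ≤ 4 →
      ∀ a : ℤ, ∃ (ℓ : ℕ) (d : ℕ → ℤ),
        (∀ i ≤ ℓ, 0 ≤ d i ∧ d i < |∏ j, N j|) ∧
        ∀ j, a = ∑ i ∈ Finset.range (ℓ + 1), d i * N j ^ i) := by
  refine ⟨fun h => part_one h, fun h4 => ?_⟩
  refine SimExp.perm (Tuple.sort (fun j => -N j)) ?_
  refine sorted_case k hk h4 _ (fun j => hle _) (fun i j hij => hcop _ _ ?_) ?_
  · exact fun h => hij ((Tuple.sort (fun j => -N j)).injective h)
  · exact Tuple.monotone_sort (fun j => -N j)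
end

section
/- Let a ∈ ℤ with a ≤ −7, and set f_a = (x − a)(x − a − 1) − 1, g_a = f_a + x − a − 1, and h_a = f_a + x − a − 2 in ℤ[x]. Let R = {0, 1, …, |f_a(0) g_a(0) h_a(0)| − 1} ⊆ ℤ. Then f_a, g_a, h_a are irreducible in ℤ[x] and pairwise coprime with pairwise coprime constant coefficients, the constant coefficients of R form a complete system of representatives of ℤ modulo f_a(0) g_a(0) h_a(0), and the simultaneous digit system defined by f_a, g_a, h_a and R has the Finite Expansion Property, i.e., it is a simultaneous number system. -/
open Polynomial

/-- Kovács-type argument: every value of a natural polynomial at `θ` has a finite expansion. -/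
theorem aux_core {V : Type*} [CommRing V] (θ : V) (p : ℕ) (hp : 0 < p) (Δ : ℕ[X])
    (hΔ1 : Δ.eval 1 = p) (hΔ : (p : V) = θ * aeval θ Δ)
    (hK : ∀ v : V, (∀ n : ℕ, θ ^ n ∣ v) → v = 0)
    (E : Set V) (h0 : (0 : V) ∈ E)
    (hE : ∀ d : ℕ, d < p → ∀ w ∈ E, (d : V) + θ * w ∈ E) :
    ∀ (S : ℕ) (c : ℕ[X]), c.eval 1 = S → aeval θ c ∈ E := by
  have step : ∀ c : ℕ[X], ∃ (d : ℕ) (c' : ℕ[X]), d < p ∧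
      aeval θ c = (d : V) + θ * aeval θ c' ∧ c.eval 1 = d + c'.eval 1 := by
    intro c
    refine ⟨c.coeff 0 % p, c.divX + C (c.coeff 0 / p) * Δ, Nat.mod_lt _ hp, ?_, ?_⟩
    · have h1 : aeval θ c = θ * aeval θ c.divX + (c.coeff 0 : V) := by
        conv_lhs => rw [← Polynomial.X_mul_divX_add c]
        simp
      have h2 : (c.coeff 0 : V) = ((c.coeff 0 % p : ℕ) : V) + (p : V) * ((c.coeff 0 / p : ℕ) : V) := by
        exact_mod_cast congrArg (Nat.cast : ℕ → V) (Nat.mod_add_div (c.coeff 0) p).symm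
      rw [h1, h2, hΔ]
      simp
      ring
    · have h1 : c.eval 1 = c.divX.eval 1 + c.coeff 0 := by
        conv_lhs => rw [← Polynomial.X_mul_divX_add c]
        simp
      have h2 := Nat.mod_add_div (c.coeff 0) p
      rw [h1]
      simp [hΔ1]
      nlinarith
  intro S
  induction S using Nat.strong_induction_on with
  | _ S ih =>
    intro c hc
    by_contra hcon
    have key : ∀ n : ℕ, ∃ c' : ℕ[X], c'.eval 1 = S ∧ aeval θ c' ∉ E ∧
        aeval θ c = θ ^ n * aeval θ c' := by
      intro n
      induction n with
      | zero => exact ⟨c, hc, hcon, by simp⟩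
      | succ n ihn =>
        obtain ⟨c', h1, h2, h3⟩ := ihn
        obtain ⟨d, c'', hd, h4, h5⟩ := step c'
        have h6 : aeval θ c'' ∉ E := fun h => h2 (h4 ▸ hE d hd _ h)
        have h7 : d = 0 := by
          by_contra hd0
          exact h6 (ih (c''.eval 1) (by omega) c'' rfl)
        subst h7
        refine ⟨c'', by omega, h6, ?_⟩
        rw [h3, h4, pow_succ]
        push_cast
        ring
    apply hcon
    rw [hK (aeval θ c) (fun n => by
      obtain ⟨c', -, -, h⟩ := key n
      exact ⟨_, h⟩)]
    exact h0

/-- If `-1` is a value of a natural polynomial, then so is every value of an integer polynomial. -/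
theorem aux_nat {V : Type*} [CommRing V] (θ : V) (M : ℕ[X]) (hM : aeval θ M = -1) (q : ℤ[X]) :
    ∃ c : ℕ[X], aeval θ c = aeval θ q := by
  induction q using Polynomial.induction_on' with
  | add p q hp hq =>
    obtain ⟨c, hc⟩ := hp
    obtain ⟨d, hd⟩ := hq
    exact ⟨c + d, by simp [hc, hd]⟩
  | monomial n z =>
    obtain ⟨k, rfl | rfl⟩ := z.eq_nat_or_neg
    · exact ⟨monomial n k, by simp [aeval_monomial]⟩
    · exact ⟨M * monomial n k, by simp [aeval_monomial, hM]⟩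

theorem aux_cast (V : Type*) [CommRing V] (m p : ℕ)
    (hp : p = (41 + 13 * m + m ^ 2) * (47 + 14 * m + m ^ 2) * (46 + 14 * m + m ^ 2)) :
    (p : V) = (41 + 13 * (m : V) + (m : V) ^ 2) * (47 + 14 * (m : V) + (m : V) ^ 2) *
      (46 + 14 * (m : V) + (m : V) ^ 2) := by
  rw [hp]
  push_cast
  ring

theorem aux_irred (b c : ℤ) (p : ℤ[X]) (hp : p = X ^ 2 + C b * X + C c)
    (h : ∀ x : ℤ, x ^ 2 + b * x + c ≠ 0) : Irreducible p := by
  have hd : p.natDegree = 2 := by subst hp; compute_degree!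
  have hm : p.Monic := by subst hp; monicity!
  rw [hm.irreducible_iff_roots_eq_zero_of_degree_le_three (by omega) (by omega)]
  apply Multiset.eq_zero_of_forall_notMem
  intro x hx
  have := (mem_roots'.1 hx).2
  subst hp
  apply h x
  simpa [IsRoot] using this

theorem aux_krull (p : ℤ[X]) (hp : Irreducible p) (h1 : 1 < p.coeff 0)
    (v : ℤ[X] ⧸ Ideal.span {p})
    (hv : ∀ n : ℕ, (Ideal.Quotient.mk (Ideal.span {p}) X) ^ n ∣ v) : v = 0 := by
  have hpr : (Ideal.span {p}).IsPrime :=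
    (Ideal.span_singleton_prime hp.ne_zero).2 hp.prime
  have hne : Ideal.span {Ideal.Quotient.mk (Ideal.span {p}) X} ≠ ⊤ := by
    intro h
    rw [Ideal.span_singleton_eq_top] at h
    obtain ⟨u, hu⟩ := h.exists_right_inv
    obtain ⟨u, rfl⟩ := Ideal.Quotient.mk_surjective u
    rw [← map_mul, ← map_one (Ideal.Quotient.mk (Ideal.span {p})), Ideal.Quotient.eq,
      Ideal.mem_span_singleton] at hu
    obtain ⟨w, hw⟩ := hu
    have := congrArg (fun q : ℤ[X] => q.coeff 0) hw
    simp [mul_coeff_zero] at this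
    have h2 : p.coeff 0 ∣ 1 := ⟨-w.coeff 0, by linarith⟩
    have := Int.le_of_dvd one_pos h2
    omega
  have hk := Ideal.iInf_pow_eq_bot_of_isDomain _ hne
  rw [← Ideal.mem_bot, ← hk, Ideal.mem_iInf]
  intro n
  rw [Ideal.span_singleton_pow, Ideal.mem_span_singleton]
  exact hv n

/-- For `a ≤ -7`, the polynomials `f_a = (x-a)(x-a-1) - 1`,
`g_a = f_a + x - a - 1`, `h_a = f_a + x - a - 2` are irreducible, pairwise
coprime with pairwise coprime constant coefficients, the constants
`{0, …, |f_a(0) g_a(0) h_a(0)| - 1}` form a complete system of representatives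
of `ℤ` modulo `f_a(0) g_a(0) h_a(0)`, and the simultaneous digit system they
define has the Finite Expansion Property. -/
theorem stmt_19 (a : ℤ) (ha : a ≤ -7)
    (fa ga ha' : ℤ[X])
    (hfa : fa = (X - C a) * (X - C a - 1) - 1)
    (hga : ga = fa + X - C a - 1)
    (hha : ha' = fa + X - C a - 2)
    (F : Fin 3 → ℤ[X]) (hF : F = ![fa, ga, ha'])
    (R : Set ℤ[X])
    (hR : R = { r | ∃ c : ℤ, 0 ≤ c ∧ c < |fa.coeff 0 * ga.coeff 0 * ha'.coeff 0| ∧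
      r = C c })
    (φ : (∀ i, ℤ[X] ⧸ Ideal.span {F i}) →+ (∀ i, ℤ[X] ⧸ Ideal.span {F i}))
    (hφ : ∀ v i, φ v i = Ideal.Quotient.mk (Ideal.span {F i}) X * v i)
    (N : Set (∀ i, ℤ[X] ⧸ Ideal.span {F i}))
    (hN : N = { v | ∃ c ∈ R, v = fun i => Ideal.Quotient.mk (Ideal.span {F i}) c }) :
    (Irreducible fa ∧ Irreducible ga ∧ Irreducible ha') ∧
    (∀ i j, i ≠ j → IsRelPrime (F i) (F j)) ∧
    (∀ i j, i ≠ j → IsCoprime ((F i).coeff 0) ((F j).coeff 0)) ∧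
    (∀ y : ℤ ⧸ Ideal.span {fa.coeff 0 * ga.coeff 0 * ha'.coeff 0},
      ∃! r, r ∈ R ∧
        Ideal.Quotient.mk (Ideal.span {fa.coeff 0 * ga.coeff 0 * ha'.coeff 0})
          (r.coeff 0) = y) ∧
    HasFEP φ N := by
  obtain ⟨m, hm⟩ : ∃ m : ℕ, a = -(7 + (m : ℤ)) := ⟨(-7 - a).toNat, by omega⟩
  have hf : fa = X ^ 2 + C (13 + 2 * (m : ℤ)) * X + C (41 + 13 * (m : ℤ) + (m : ℤ) ^ 2) := by
    rw [hfa, hm]; simp; ring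
  have hg : ga = X ^ 2 + C (14 + 2 * (m : ℤ)) * X + C (47 + 14 * (m : ℤ) + (m : ℤ) ^ 2) := by
    rw [hga, hf, hm]; simp; ring
  have hh : ha' = X ^ 2 + C (14 + 2 * (m : ℤ)) * X + C (46 + 14 * (m : ℤ) + (m : ℤ) ^ 2) := by
    rw [hha, hf, hm]; simp; ring
  have hf0 : fa.coeff 0 = 41 + 13 * (m : ℤ) + (m : ℤ) ^ 2 := by rw [hf]; simp only [coeff_add, coeff_C_zero, mul_coeff_zero, coeff_X_zero, coeff_X_pow]; simp
  have hg0 : ga.coeff 0 = 47 + 14 * (m : ℤ) + (m : ℤ) ^ 2 := by rw [hg]; simp only [coeff_add, coeff_C_zero, mul_coeff_zero, coeff_X_zero, coeff_X_pow]; simp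
  have hh0 : ha'.coeff 0 = 46 + 14 * (m : ℤ) + (m : ℤ) ^ 2 := by rw [hh]; simp only [coeff_add, coeff_C_zero, mul_coeff_zero, coeff_X_zero, coeff_X_pow]; simp
  have hfi : Irreducible fa := by
    apply aux_irred _ _ _ hf
    intro x hx
    have h1 : (x + 7 + m) * (x + 7 + m - 1) = 1 := by linarith
    have h2 := Int.even_mul_pred_self (x + 7 + m)
    rw [h1] at h2
    exact absurd h2 (by decide)
  have hgi : Irreducible ga := by
    apply aux_irred _ _ _ hg
    intro x hx
    have h1 : (x + 7 + m) * (x + 7 + m) = 2 := by linarith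
    have h2 : x + 7 + m < 2 := by nlinarith
    have h3 : -2 < x + 7 + m := by nlinarith
    generalize x + 7 + (m : ℤ) = t at *
    interval_cases t <;> omega
  have hhi : Irreducible ha' := by
    apply aux_irred _ _ _ hh
    intro x hx
    have h1 : (x + 7 + m) * (x + 7 + m) = 3 := by linarith
    have h2 : x + 7 + m < 2 := by nlinarith
    have h3 : -2 < x + 7 + m := by nlinarith
    generalize x + 7 + (m : ℤ) = t at *
    interval_cases t <;> omega
  -- Bezout relations, with `t = x - a`
  have cfg : IsCoprime fa ga := by
    refine ⟨-(X - C a + 1), X - C a, ?_⟩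
    rw [hga, hfa]; ring
  have cfh : IsCoprime fa ha' := by
    refine ⟨X - C a + 2, -(X - C a + 1), ?_⟩
    rw [hha, hfa]; ring
  have cgh : IsCoprime ga ha' := by
    refine ⟨1, -1, ?_⟩
    rw [hga, hha]; ring
  have hcop : ∀ i j, i ≠ j → IsCoprime (F i) (F j) := by
    intro i j hij
    subst hF
    fin_cases i <;> fin_cases j <;>
      first
        | exact absurd rfl hij
        | exact cfg
        | exact cfh
        | exact cgh
        | exact cfg.symm
        | exact cfh.symm
        | exact cgh.symm
  have hirr : ∀ i, Irreducible (F i) ∧ 1 < (F i).coeff 0 := by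
    intro i
    subst hF
    fin_cases i
    · exact ⟨hfi, by show 1 < fa.coeff 0; rw [hf0]; nlinarith [Int.natCast_nonneg m]⟩
    · exact ⟨hgi, by show 1 < ga.coeff 0; rw [hg0]; nlinarith [Int.natCast_nonneg m]⟩
    · exact ⟨hhi, by show 1 < ha'.coeff 0; rw [hh0]; nlinarith [Int.natCast_nonneg m]⟩
  -- the constant coefficient of the product
  obtain ⟨p, hpdef⟩ : ∃ p : ℕ, p = (41 + 13 * m + m ^ 2) * (47 + 14 * m + m ^ 2) *
    (46 + 14 * m + m ^ 2) := ⟨_, rfl⟩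
  have hp : 0 < p := by rw [hpdef]; positivity
  have hpz : fa.coeff 0 * ga.coeff 0 * ha'.coeff 0 = (p : ℤ) := by
    rw [hf0, hg0, hh0, hpdef]; push_cast; ring
  have hpabs : |fa.coeff 0 * ga.coeff 0 * ha'.coeff 0| = (p : ℤ) := by
    rw [hpz]; simp
  refine ⟨⟨hfi, hgi, hhi⟩, fun i j hij => (hcop i j hij).isRelPrime, ?_, ?_, ?_⟩
  · intro i j hij
    simpa [coeff_zero_eq_eval_zero] using (hcop i j hij).map (evalRingHom (0 : ℤ))
  · rw [hpabs] at hR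
    rw [hpz]
    intro y
    obtain ⟨z, rfl⟩ := Ideal.Quotient.mk_surjective y
    have hpz' : (0 : ℤ) < p := by exact_mod_cast hp
    refine ⟨C (z % p), ⟨?_, ?_⟩, ?_⟩
    · rw [hR]
      exact ⟨_, Int.emod_nonneg _ hpz'.ne', Int.emod_lt_of_pos _ hpz', rfl⟩
    · rw [Ideal.Quotient.eq, Ideal.mem_span_singleton, coeff_C_zero]
      exact ⟨-(z / p), by linarith [Int.emod_add_mul_ediv z p]⟩
    · rintro r ⟨hr, hr2⟩
      rw [hR] at hr
      obtain ⟨c, hc0, hc1, rfl⟩ := hr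
      rw [Ideal.Quotient.eq, Ideal.mem_span_singleton, coeff_C_zero] at hr2
      have : z % p = c % p := Int.modEq_iff_dvd.2 hr2
      rw [this, Int.emod_eq_of_lt hc0 hc1]
  · rw [hpabs] at hR
    let V := ∀ i, ℤ[X] ⧸ Ideal.span {F i}
    let θ : V := fun i => Ideal.Quotient.mk (Ideal.span {F i}) X
    have hφθ : ∀ v, φ v = θ * v := fun v => funext fun i => hφ v i
    have haev : ∀ (q : ℤ[X]), aeval θ q = fun i => Ideal.Quotient.mk (Ideal.span {F i}) q := by
      intro q
      let Φ : ℤ[X] →+* V := RingHom.pi fun i => Ideal.Quotient.mk (Ideal.span {F i})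
      have : (aeval θ : ℤ[X] →ₐ[ℤ] V).toRingHom = Φ := by
        apply Polynomial.ringHom_ext'
        · exact RingHom.ext_int _ _
        · simp [Φ, θ]
          rfl
      exact congrArg (fun g : ℤ[X] →+* V => g q) this
    have hsurj : ∀ v : V, ∃ q : ℤ[X], aeval θ q = v := by
      intro v
      obtain ⟨q, hq⟩ := Ideal.pi_quotient_surjective (I := fun i => Ideal.span {F i})
        (fun i j hij => (Ideal.isCoprime_span_singleton_iff _ _).2 (hcop i j hij)) v
      exact ⟨q, by rw [haev]; exact funext hq⟩
    have hkill : aeval θ (fa * ga * ha') = 0 := by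
      rw [haev]
      funext i
      show Ideal.Quotient.mk (Ideal.span {F i}) (fa * ga * ha') = 0
      rw [Ideal.Quotient.eq_zero_iff_mem, Ideal.mem_span_singleton]
      subst hF
      fin_cases i
      · exact ⟨ga * ha', by show _ = fa * _; ring⟩
      · exact ⟨fa * ha', by show _ = ga * _; ring⟩
      · exact ⟨fa * ga, by show _ = ha' * _; ring⟩
    have hkill2 : (θ ^ 2 + (13 + 2 * (m : V)) * θ + (41 + 13 * (m : V) + (m : V) ^ 2)) *
        (θ ^ 2 + (14 + 2 * (m : V)) * θ + (47 + 14 * (m : V) + (m : V) ^ 2)) *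
        (θ ^ 2 + (14 + 2 * (m : V)) * θ + (46 + 14 * (m : V) + (m : V) ^ 2)) = 0 := by
      rw [← hkill, hf, hg, hh]
      simp [map_ofNat]
    obtain ⟨Δ, hΔdef⟩ : ∃ Δ : ℕ[X], Δ = 
      C (7154 + 19614 * m ^ 1 + 12316 * m ^ 2 + 3431 * m ^ 3 + 489 * m ^ 4 + 35 * m ^ 5 + 1 * m ^ 6) * X ^ 0 +
      C (50551 + 43253 * m ^ 1 + 14457 * m ^ 2 + 2366 * m ^ 3 + 190 * m ^ 4 + 6 * m ^ 5) * X ^ 1 +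
      C (24730 + 15845 * m ^ 1 + 3754 * m ^ 2 + 390 * m ^ 3 + 15 * m ^ 4) * X ^ 2 +
      C (5513 + 2571 * m ^ 1 + 395 * m ^ 2 + 20 * m ^ 3) * X ^ 3 +
      C (653 + 199 * m ^ 1 + 15 * m ^ 2) * X ^ 4 +
      C (40 + 6 * m ^ 1) * X ^ 5 +
      X ^ 6 := ⟨_, rfl⟩
    obtain ⟨M, hMdef⟩ : ∃ M : ℕ[X], M = 
      C (88641 + 81488 * m ^ 1 + 30937 * m ^ 2 + 6207 * m ^ 3 + 694 * m ^ 4 + 41 * m ^ 5 + 1 * m ^ 6) * X ^ 0 +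
      C (81488 + 61874 * m ^ 1 + 18621 * m ^ 2 + 2776 * m ^ 3 + 205 * m ^ 4 + 6 * m ^ 5) * X ^ 1 +
      C (30937 + 18621 * m ^ 1 + 4164 * m ^ 2 + 410 * m ^ 3 + 15 * m ^ 4) * X ^ 2 +
      C (6207 + 2776 * m ^ 1 + 410 * m ^ 2 + 20 * m ^ 3) * X ^ 3 +
      C (694 + 205 * m ^ 1 + 15 * m ^ 2) * X ^ 4 +
      C (41 + 6 * m ^ 1) * X ^ 5 +
      X ^ 6 := ⟨_, rfl⟩
    have hΔ1 : Δ.eval 1 = p := by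
      rw [hΔdef, hpdef]
      simp
      ring
    have hpV : (p : V) = (41 + 13 * (m : V) + (m : V) ^ 2) * (47 + 14 * (m : V) + (m : V) ^ 2) *
        (46 + 14 * (m : V) + (m : V) ^ 2) := aux_cast V m p hpdef
    have hΔ : (p : V) = θ * aeval θ Δ := by
      rw [hΔdef, hpV]
      simp [map_ofNat]
      linear_combination (1 - θ) * hkill2
    have hM : aeval θ M = -1 := by
      rw [hMdef]
      simp [map_ofNat]
      linear_combination hkill2
    have hK : ∀ v : V, (∀ n : ℕ, θ ^ n ∣ v) → v = 0 := by
      intro v hv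
      funext i
      refine aux_krull (F i) (hirr i).1 (hirr i).2 (v i) fun n => ?_
      obtain ⟨w, hw⟩ := hv n
      exact ⟨w i, by rw [hw]; rfl⟩
    have hdig : ∀ d : ℕ, d < p → (d : V) ∈ N := by
      intro d hd
      rw [hN]
      refine ⟨C (d : ℤ), ?_, ?_⟩
      · rw [hR]
        exact ⟨d, by positivity, by exact_mod_cast hd, rfl⟩
      · rw [← haev]
        simp
    intro v
    obtain ⟨q, rfl⟩ := hsurj v
    obtain ⟨c, hc⟩ := aux_nat θ M hM q
    suffices main : aeval θ c ∈ {v : V | ∃ (ℓ : ℕ) (d : ℕ → V), (∀ i ≤ ℓ, d i ∈ N) ∧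
        v = ∑ i ∈ Finset.range (ℓ + 1), φ^[i] (d i)} by
      obtain ⟨ℓ, d, h1, h2⟩ := main
      exact ⟨ℓ, d, h1, hc.symm.trans h2⟩
    refine aux_core θ p hp Δ hΔ1 hΔ hK {v : V | ∃ (ℓ : ℕ) (d : ℕ → V), (∀ i ≤ ℓ, d i ∈ N) ∧
      v = ∑ i ∈ Finset.range (ℓ + 1), φ^[i] (d i)} ?_ ?_ _ c rfl
    · refine ⟨0, fun _ => 0, fun i _ => ?_, by simp⟩
      simpa using hdig 0 hp
    · rintro d hd w ⟨ℓ, e, he, rfl⟩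
      refine ⟨ℓ + 1, fun i => if i = 0 then (d : V) else e (i - 1), ?_, ?_⟩
      · intro i hi
        by_cases h : i = 0
        · simpa [h] using hdig d hd
        · simpa [h] using he (i - 1) (by omega)
      · rw [Finset.sum_range_succ' _ (ℓ + 1), ← hφθ, map_sum, add_comm]
        simp [Function.iterate_succ_apply']
end
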